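/- Let N be a positive integer, 𝔞 ∈ 𝔈₁, t a positive divisor of N, u,v,k integers with gcd(u,t)=1 and uv ≡ 1 mod t, ℓ an integer coprime to N, and ℓ* an integer with ℓℓ* ≡ 1 mod N. There exists a sequence (c_n)_{n∈ℤ} of elements of ℚ(ζ), vanishing for all n below some bound, such that for all τ in the upper half-plane W_𝔞(B(t,u,v,k)·τ) = Σ_n c_n q^n, and moreover Σ_n σ_ℓ(c_n) q^n equals W_{ℓ𝔞}(B(t,u,v,k)·τ) if t = N, and equals W_𝔞(B(t,ℓ*u,ℓv,ℓk)·τ) if t ≠ N, for all τ in the upper half-plane; here ℓ𝔞 = [{ℓa₁},{ℓa₂},{ℓa₃}]. -/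

import Mathlib

open scoped MatrixGroups
open Complex

/-- The Weierstrass ℘-function of the lattice `L_τ = ℤ + ℤτ`. -/
noncomputable def wp (τ z : ℂ) : ℂ :=
  1 / z ^ 2 + ∑' p : {p : ℤ × ℤ // p ≠ 0},
    (1 / (z - ((p.1.1 : ℂ) + (p.1.2 : ℂ) * τ)) ^ 2 - 1 / ((p.1.1 : ℂ) + (p.1.2 : ℂ) * τ) ^ 2)

/-- The function `W_𝔞` for the triple `𝔞 = [a₁,a₂,a₃]`. -/
noncomputable def Wfun (N : ℕ) (a₁ a₂ a₃ : ℤ) (τ : ℂ) : ℂ :=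
  (wp τ ((a₁ : ℂ) / N) - wp τ ((a₃ : ℂ) / N)) / (wp τ ((a₂ : ℂ) / N) - wp τ ((a₃ : ℂ) / N))

/-- Möbius action of an integral 2×2 matrix on ℂ. -/
noncomputable def moebius (A : Matrix (Fin 2) (Fin 2) ℤ) (τ : ℂ) : ℂ :=
  ((A 0 0 : ℂ) * τ + (A 0 1 : ℂ)) / ((A 1 0 : ℂ) * τ + (A 1 1 : ℂ))

/-- `𝔖_N = (ℤ/Nℤ)ˣ/{±1}`. -/
abbrev SNgroup (N : ℕ) := (ZMod N)ˣ ⧸ (Subgroup.closure ({-1} : Set (ZMod N)ˣ))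

/-- The triple `𝔞 = [a₁,a₂,a₃]` is in `𝔈`. -/
def memE (N : ℕ) (a : ℤ × ℤ × ℤ) : Prop :=
  0 < a.1 ∧ 0 < a.2.1 ∧ 0 < a.2.2 ∧ 2 * a.1 ≤ (N : ℤ) ∧ 2 * a.2.1 ≤ (N : ℤ) ∧
    2 * a.2.2 ≤ (N : ℤ) ∧ a.1 ≠ a.2.1 ∧ a.1 ≠ a.2.2 ∧ a.2.1 ≠ a.2.2

def memE1 (N : ℕ) (a : ℤ × ℤ × ℤ) : Prop :=
  memE N a ∧ IsCoprime (a.1 * a.2.1 * a.2.2) (N : ℤ)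

def memE2 (N : ℕ) (a : ℤ × ℤ × ℤ) : Prop :=
  memE1 N a ∧ IsCoprime (a.1 - a.2.2) (N : ℤ) ∧ IsCoprime (a.1 + a.2.2) (N : ℤ) ∧
    IsCoprime (a.2.1 - a.2.2) (N : ℤ) ∧ IsCoprime (a.2.1 + a.2.2) (N : ℤ)

/-- `M` is a lift to `Γ₀(N)` of `diag(λ⁻¹, λ)` for the class `s = λ ∈ 𝔖_N`. -/
def IsDiagLift (N : ℕ) (M : SL(2, ℤ)) (s : SNgroup N) : Prop :=
  ∃ u : (ZMod N)ˣ, (QuotientGroup.mk u : SNgroup N) = s ∧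
    ((M 0 0 : ℤ) : ZMod N) = ((u⁻¹ : (ZMod N)ˣ) : ZMod N) ∧
    ((M 0 1 : ℤ) : ZMod N) = 0 ∧ ((M 1 0 : ℤ) : ZMod N) = 0 ∧
    ((M 1 1 : ℤ) : ZMod N) = (u : ZMod N)

/-- The function `T_{𝔄,F}`. -/
noncomputable def Tfun (N : ℕ) {n : ℕ} (A : Fin n → ℤ × ℤ × ℤ)
    (F : MvPolynomial (Fin n) ℤ) (M : SNgroup N → SL(2, ℤ)) (τ : ℂ) : ℂ :=
  ∑ᶠ s : SNgroup N, MvPolynomial.aeval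
    (fun i => Wfun N (A i).1 (A i).2.1 (A i).2.2 (moebius ((M s : SL(2, ℤ)) : Matrix (Fin 2) (Fin 2) ℤ) τ)) F

/-- The matrix `B(t,u,v,k)`. -/
def Bmat (t : ℕ) (u v k : ℤ) : Matrix (Fin 2) (Fin 2) ℤ :=
  !![u, (u * v - 1) / (t : ℤ) + u * k; (t : ℤ), v + (t : ℤ) * k]

/-- `{a}` : the representative of `±a mod N` in `(0, N/2]` (paper's `{·}`). -/
def red (N : ℕ) (a : ℤ) : ℤ :=
  if 2 * (a % (N : ℤ)) ≤ (N : ℤ) then a % (N : ℤ) else (N : ℤ) - a % (N : ℤ)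

/-- `μ(a) ∈ {±1}` with `a ≡ μ(a){a} mod N`. -/
def muSign (N : ℕ) (a : ℤ) : ℤ :=
  if 2 * (a % (N : ℤ)) ≤ (N : ℤ) then 1 else -1

/-- `φ_s(τ) = (2πi)⁻²℘(s/N; L_τ) − 1/12`. -/
noncomputable def phiFun (N : ℕ) (s : ℤ) (τ : ℂ) : ℂ :=
  (1 / (2 * (Real.pi : ℂ) * Complex.I) ^ 2) * wp τ ((s : ℂ) / N) - 1 / 12

/-- `f[A]₂` : weight-2 slash of `φ_s`. -/
noncomputable def phiSlash (N : ℕ) (s : ℤ) (A : Matrix (Fin 2) (Fin 2) ℤ) (τ : ℂ) : ℂ :=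
  phiFun N s (moebius A τ) * ((A 1 0 : ℂ) * τ + (A 1 1 : ℂ)) ^ (-2 : ℤ)

/-- `q = e^{2πiτ/N}`. -/
noncomputable def qq (N : ℕ) (τ : ℂ) : ℂ :=
  Complex.exp (2 * (Real.pi : ℂ) * Complex.I * τ / N)

/-- `ζ = e^{2πi/N}`. -/
noncomputable def zetaN (N : ℕ) : ℂ :=
  Complex.exp (2 * (Real.pi : ℂ) * Complex.I / N)

/-- `θ_{a,b} = ζ^a(1−ζ^{b−a})(1−ζ^{b+a})/((1−ζ^a)²(1−ζ^b)²)`. -/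
noncomputable def theta (ζ : ℂ) (a b : ℤ) : ℂ :=
  ζ ^ a * (1 - ζ ^ (b - a)) * (1 - ζ ^ (b + a)) / ((1 - ζ ^ a) ^ 2 * (1 - ζ ^ b) ^ 2)

/-- The `q`-Pochhammer symbol `(x; Q)_∞ = ∏_{n ≥ 0} (1 - Qⁿ x)`. -/
noncomputable def qPoch (Q x : ℂ) : ℂ := ∏' n : ℕ, (1 + -(Q ^ n * x))

lemma summable_qPoch {Q : ℂ} (hQ : ‖Q‖ < 1) (x : ℂ) :
    Summable fun n : ℕ => ‖-(Q ^ n * x)‖ := by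
  simpa using (summable_geometric_of_lt_one (norm_nonneg _) hQ).mul_right ‖x‖

lemma qPoch_eq_mul {Q : ℂ} (hQ : ‖Q‖ < 1) (x : ℂ) : qPoch Q x = (1 - x) * qPoch Q (Q * x) := by
  have h := (multipliable_one_add_of_summable (summable_qPoch hQ (Q * x)))
  have h' : (fun n : ℕ => 1 + -(Q ^ n * (Q * x))) = fun n : ℕ => 1 + -(Q ^ (n + 1) * x) := by
    funext n; ring
  rw [h'] at h
  have h2 := tprod_eq_zero_mul' (f := fun n : ℕ => 1 + -(Q ^ n * x)) h
  rw [qPoch, qPoch, h', h2]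
  simp [sub_eq_add_neg]

lemma qPoch_ne_zero {Q : ℂ} (hQ : ‖Q‖ < 1) {x : ℂ} (hx : ∀ n : ℕ, Q ^ n * x ≠ 1) :
    qPoch Q x ≠ 0 := by
  refine tprod_one_add_ne_zero_of_summable (fun n h => hx n ?_) (summable_qPoch hQ x)
  linear_combination -h

lemma qPoch_one {Q : ℂ} (hQ : ‖Q‖ < 1) : qPoch Q 1 = 0 := by
  rw [qPoch_eq_mul hQ]; simp

lemma hasProdLocallyUniformlyOn_one_add_of_forall_compact {E : Type*} [NormedCommRing E]
    [NormOneClass E] [CompleteSpace E] {U : Set ℂ} (hU : IsOpen U) {f : ℕ → ℂ → E}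
    (hf : ∀ n, ContinuousOn (f n) U)
    (hb : ∀ K ⊆ U, IsCompact K → ∃ u : ℕ → ℝ, Summable u ∧ ∀ n, ∀ x ∈ K, ‖f n x‖ ≤ u n) :
    HasProdLocallyUniformlyOn (fun n x => 1 + f n x) (fun x => ∏' n, (1 + f n x)) U := by
  refine hasProdLocallyUniformlyOn_of_forall_compact hU fun K hK hKc => ?_
  obtain ⟨u, hu, h⟩ := hb K hK hKc
  exact Summable.hasProdUniformlyOn_nat_one_add hKc hu (.of_forall h) fun n => (hf n).mono hK

lemma differentiable_qPoch {Q : ℂ} (hQ : ‖Q‖ < 1) : Differentiable ℂ (qPoch Q) := by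
  rw [← differentiableOn_univ]
  have h := hasProdLocallyUniformlyOn_one_add_of_forall_compact (U := Set.univ) isOpen_univ
    (f := fun n x => -(Q ^ n * x)) (fun n => by fun_prop) (fun K _ hK => by
      obtain ⟨R, hR⟩ := hK.isBounded.exists_norm_le
      refine ⟨fun n => ‖Q‖ ^ n * R,
        (summable_geometric_of_lt_one (norm_nonneg _) hQ).mul_right R, fun n x hx => ?_⟩
      simp only [norm_neg, norm_mul, norm_pow]
      gcongr
      exact hR x hx)
  exact h.differentiableOn (.of_forall fun s => by
    simpa [Finset.prod_fn] using DifferentiableOn.finsetProd (fun _ _ => by fun_prop)) isOpen_univ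

/-- The theta product `∏_{n ≥ 0} (1 - Qⁿ x) (1 - Qⁿ⁺¹ x⁻¹)`. -/
noncomputable def thetaProd (Q x : ℂ) : ℂ := qPoch Q x * qPoch Q (Q * x⁻¹)

lemma thetaProd_mul {Q x : ℂ} (hQ : ‖Q‖ < 1) (hQ0 : Q ≠ 0) (hx : x ≠ 0) :
    thetaProd Q (Q * x) = -x⁻¹ * thetaProd Q x := by
  have h1 : Q * (Q * x)⁻¹ = x⁻¹ := by field_simp
  rw [thetaProd, thetaProd, h1, qPoch_eq_mul hQ x, qPoch_eq_mul hQ x⁻¹]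
  field_simp
  ring

lemma thetaProd_inv {Q x : ℂ} (hQ : ‖Q‖ < 1) (hx : x ≠ 0) :
    thetaProd Q x⁻¹ = -x⁻¹ * thetaProd Q x := by
  rw [thetaProd, thetaProd, inv_inv, qPoch_eq_mul hQ x, qPoch_eq_mul hQ x⁻¹]
  field_simp
  ring

lemma thetaProd_ne_zero {Q x : ℂ} (hQ : ‖Q‖ < 1) (hx : ∀ n : ℤ, Q ^ n * x ≠ 1) :
    thetaProd Q x ≠ 0 := by
  refine mul_ne_zero (qPoch_ne_zero hQ fun n => mod_cast hx n) (qPoch_ne_zero hQ fun n h => ?_)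
  rcases eq_or_ne x 0 with rfl | hx0
  · simp at h
  refine hx (-(n + 1 : ℕ)) ?_
  have h2 : Q ^ (n + 1) = x := by
    rw [pow_succ]
    field_simp at h
    linear_combination h
  rw [zpow_neg, zpow_natCast, h2, inv_mul_cancel₀ hx0]

lemma thetaProd_one {Q : ℂ} (hQ : ‖Q‖ < 1) : thetaProd Q 1 = 0 := by
  rw [thetaProd, qPoch_one hQ, zero_mul]

/-- An elliptic function whose only poles are at lattice points, with principal part `c / z ^ 2`
at the origin, equals `c • ℘` up to an additive constant. -/
lemma PeriodPair.exists_eq_mul_weierstrassP_add (L : PeriodPair) {h H : ℂ → ℂ} {c : ℂ}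
    (hd : DifferentiableOn ℂ h (L.lattice : Set ℂ)ᶜ)
    (hper : ∀ z, ∀ l ∈ L.lattice, h (z + l) = h z)
    (hH : AnalyticAt ℂ H 0) (hc : ∀ᶠ z in nhdsWithin 0 {0}ᶜ, h z = c / z ^ 2 + H z) :
    ∃ K : ℂ, ∀ z ∉ L.lattice, h z = c * L.weierstrassP z + K := by
  classical
  let G : ℂ → ℂ := fun z => if z ∈ L.lattice then H 0 - c * L.weierstrassPExcept 0 0
    else h z - c * L.weierstrassP z
  have hGper : ∀ z, ∀ l ∈ L.lattice, G (z + l) = G z := by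
    intro z l hl
    have h1 : z + l ∈ L.lattice ↔ z ∈ L.lattice := L.lattice.toAddSubgroup.add_mem_cancel_right hl
    simp only [G, h1, hper z l hl]
    rw [L.weierstrassP_add_coe z ⟨l, hl⟩]
  have hG0 : AnalyticAt ℂ G 0 := by
    have hE : AnalyticAt ℂ (fun z => H z - c * L.weierstrassPExcept 0 z) 0 := by
      have := L.analyticAt_weierstrassPExcept 0
      fun_prop
    refine hE.congr ?_
    rw [eventually_nhdsWithin_iff] at hc
    filter_upwards [hc, L.compl_lattice_sdiff_singleton_mem_nhds 0] with z hz hz'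
    by_cases hz0 : z = 0
    · simp [G, hz0]
    have hzL : z ∉ L.lattice := by simp_all
    have := L.weierstrassPExcept_def 0 z
    simp only [ZeroMemClass.coe_zero] at this
    simp only [G, hzL, if_false, hz hz0, this]
    simp
    ring
  have hG : Differentiable ℂ G := by
    intro x
    by_cases hx : x ∈ L.lattice
    · have h1 : G = fun z => G (z - x) := by
        funext z
        conv_lhs => rw [← sub_add_cancel z x, hGper _ x hx]
      rw [h1]
      have h2 : DifferentiableAt ℂ G (x - x) := by simpa using hG0.differentiableAt
      exact h2.comp x (f := fun z => z - x) (by fun_prop)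
    · have hU := L.isClosed_lattice.isOpen_compl.mem_nhds hx
      have h1 := (hd.differentiableAt hU).sub
        ((L.differentiableOn_weierstrassP.differentiableAt hU).const_mul c)
      refine h1.congr_of_eventuallyEq ?_
      filter_upwards [hU] with z hz
      have : z ∉ L.lattice := hz
      simp [G, this]
  refine ⟨G 0, fun z hz => ?_⟩
  have := hG.apply_eq_apply_of_bounded (IsZLattice.isCompact_range_of_periodic L.lattice _
    hG.continuous fun z w hw => hGper z w hw).isBounded z 0
  simp only [G, hz, if_false] at this
  simp only [G]
  rw [← this]
  ring

/-- The period pair `(1, τ)`. -/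
noncomputable def periodPair (τ : ℂ) (hτ : 0 < τ.im) : PeriodPair where
  ω₁ := 1
  ω₂ := τ
  indep := by
    rw [LinearIndependent.pair_iff]
    intro s t h
    have h2 := congrArg Complex.im h
    have h1 := congrArg Complex.re h
    simp at h1 h2
    have ht : t = 0 := by simpa [hτ.ne'] using h2
    simp [ht] at h1
    exact ⟨h1, ht⟩

lemma mem_periodPair_lattice {τ : ℂ} {hτ : 0 < τ.im} {z : ℂ} :
    z ∈ (periodPair τ hτ).lattice ↔ ∃ m n : ℤ, (m : ℂ) + n * τ = z := by
  simp [PeriodPair.mem_lattice, periodPair]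

lemma hasSum_wp {τ : ℂ} (hτ : 0 < τ.im) (z : ℂ) :
    HasSum (fun p : ℤ × ℤ => 1 / (z - ((p.1 : ℂ) + (p.2 : ℂ) * τ)) ^ 2 -
      1 / ((p.1 : ℂ) + (p.2 : ℂ) * τ) ^ 2) ((periodPair τ hτ).weierstrassP z) := by
  have h := (periodPair τ hτ).hasSum_weierstrassP z
  rw [← (periodPair τ hτ).latticeEquivProd.symm.toEquiv.hasSum_iff] at h
  refine h.congr_fun fun p => ?_
  have := (periodPair τ hτ).latticeEquiv_symm_apply p
  simp only [Function.comp]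
  erw [this]
  simp [periodPair]

lemma wp_eq_tsum {τ : ℂ} (hτ : 0 < τ.im) (z : ℂ) :
    wp τ z = ∑' p : ℤ × ℤ, (1 / (z - ((p.1 : ℂ) + (p.2 : ℂ) * τ)) ^ 2 -
      1 / ((p.1 : ℂ) + (p.2 : ℂ) * τ) ^ 2) := by
  have h := (hasSum_wp hτ z).summable
  rw [← h.tsum_subtype_add_tsum_subtype_compl {0}, wp]
  congr 1
  simp

lemma wp_eq_weierstrassP {τ : ℂ} (hτ : 0 < τ.im) (z : ℂ) :
    wp τ z = (periodPair τ hτ).weierstrassP z :=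
  (wp_eq_tsum hτ z).trans (hasSum_wp hτ z).tsum_eq

/-- The normalised exponential `z ↦ exp (2πiz)`. -/
noncomputable def expTwoPiI (z : ℂ) : ℂ := Complex.exp (2 * (Real.pi : ℂ) * Complex.I * z)

lemma expTwoPiI_ne_zero (z : ℂ) : expTwoPiI z ≠ 0 := Complex.exp_ne_zero _

lemma expTwoPiI_add (z w : ℂ) : expTwoPiI (z + w) = expTwoPiI z * expTwoPiI w := by
  rw [expTwoPiI, mul_add, Complex.exp_add]; rfl

lemma expTwoPiI_neg (z : ℂ) : expTwoPiI (-z) = (expTwoPiI z)⁻¹ := by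
  rw [expTwoPiI, mul_neg, Complex.exp_neg]; rfl

lemma expTwoPiI_int_mul (n : ℤ) (z : ℂ) : expTwoPiI (n * z) = expTwoPiI z ^ n := by
  rw [expTwoPiI, expTwoPiI, ← Complex.exp_int_mul]; ring_nf

@[simp] lemma expTwoPiI_zero : expTwoPiI 0 = 1 := by simp [expTwoPiI]

@[simp] lemma expTwoPiI_one : expTwoPiI 1 = 1 := by simp [expTwoPiI, Complex.exp_two_pi_mul_I]

lemma expTwoPiI_eq_one_iff {z : ℂ} : expTwoPiI z = 1 ↔ ∃ m : ℤ, z = m := by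
  rw [expTwoPiI, Complex.exp_eq_one_iff]
  refine exists_congr fun m => ?_
  rw [mul_comm (m : ℂ), mul_right_inj' Complex.two_pi_I_ne_zero]

lemma norm_expTwoPiI_lt_one {τ : ℂ} (hτ : 0 < τ.im) : ‖expTwoPiI τ‖ < 1 :=
  UpperHalfPlane.norm_exp_two_pi_I_lt_one ⟨τ, hτ⟩

@[fun_prop] lemma differentiable_expTwoPiI : Differentiable ℂ expTwoPiI := by
  unfold expTwoPiI; fun_prop

/-- The theta function attached to `ℤ + ℤτ` given by the theta product. -/
noncomputable def thetaFun (τ z : ℂ) : ℂ := thetaProd (expTwoPiI τ) (expTwoPiI z)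

lemma thetaFun_add_one (τ z : ℂ) : thetaFun τ (z + 1) = thetaFun τ z := by
  simp [thetaFun, expTwoPiI_add]

lemma thetaFun_add_self {τ : ℂ} (hτ : 0 < τ.im) (z : ℂ) :
    thetaFun τ (z + τ) = -(expTwoPiI z)⁻¹ * thetaFun τ z := by
  rw [thetaFun, add_comm, expTwoPiI_add, thetaProd_mul (norm_expTwoPiI_lt_one hτ)
    (expTwoPiI_ne_zero _) (expTwoPiI_ne_zero _)]
  rfl

lemma thetaFun_neg {τ : ℂ} (hτ : 0 < τ.im) (z : ℂ) :
    thetaFun τ (-z) = -(expTwoPiI z)⁻¹ * thetaFun τ z := by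
  rw [thetaFun, expTwoPiI_neg, thetaProd_inv (norm_expTwoPiI_lt_one hτ) (expTwoPiI_ne_zero _)]
  rfl

lemma thetaFun_ne_zero {τ : ℂ} (hτ : 0 < τ.im) {z : ℂ} (hz : z ∉ (periodPair τ hτ).lattice) :
    thetaFun τ z ≠ 0 := by
  refine thetaProd_ne_zero (norm_expTwoPiI_lt_one hτ) fun n h => hz ?_
  rw [← expTwoPiI_int_mul, ← expTwoPiI_add, expTwoPiI_eq_one_iff] at h
  obtain ⟨m, hm⟩ := h
  refine mem_periodPair_lattice.2 ⟨m, -n, ?_⟩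
  rw [← hm]; push_cast; ring

lemma differentiable_thetaFun {τ : ℂ} (hτ : 0 < τ.im) : Differentiable ℂ (thetaFun τ) := by
  have h := differentiable_qPoch (norm_expTwoPiI_lt_one hτ)
  have h1 : thetaFun τ = fun z => qPoch (expTwoPiI τ) (expTwoPiI z) *
      qPoch (expTwoPiI τ) (expTwoPiI τ * expTwoPiI (-z)) := by
    funext z; rw [expTwoPiI_neg]; rfl
  rw [h1]
  fun_prop

lemma thetaFun_zero {τ : ℂ} (hτ : 0 < τ.im) : thetaFun τ 0 = 0 := by
  rw [thetaFun, expTwoPiI_zero, thetaProd_one (norm_expTwoPiI_lt_one hτ)]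

lemma deriv_thetaFun_zero_ne_zero {τ : ℂ} (hτ : 0 < τ.im) : deriv (thetaFun τ) 0 ≠ 0 := by
  have hQ := norm_expTwoPiI_lt_one hτ
  set P : ℂ → ℂ := fun z => qPoch (expTwoPiI τ) (expTwoPiI τ * expTwoPiI z) *
      qPoch (expTwoPiI τ) (expTwoPiI τ * expTwoPiI (-z)) with hP
  have h := differentiable_qPoch hQ
  have h1 : thetaFun τ = fun z => (1 - expTwoPiI z) * P z := by
    funext z
    simp only [hP, thetaFun, thetaProd, expTwoPiI_neg]
    rw [qPoch_eq_mul hQ (expTwoPiI z)]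
    ring
  have hPd : Differentiable ℂ P := by fun_prop
  have he : HasDerivAt expTwoPiI (2 * (Real.pi : ℂ) * Complex.I) 0 := by
    have := ((hasDerivAt_id (0 : ℂ)).const_mul (2 * (Real.pi : ℂ) * Complex.I)).cexp
    simpa [expTwoPiI] using! this
  have hd := (he.const_sub 1).mul (hPd 0).hasDerivAt
  rw [h1]
  change deriv ((fun x => 1 - expTwoPiI x) * P) 0 ≠ 0
  rw [hd.deriv]
  have hne : qPoch (expTwoPiI τ) (expTwoPiI τ) ≠ 0 := by
    refine qPoch_ne_zero hQ fun n h => ?_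
    have h2 := congrArg norm h
    rw [← pow_succ, norm_pow, norm_one] at h2
    exact (pow_lt_one₀ (norm_nonneg _) hQ (Nat.succ_ne_zero n)).ne h2
  simp [hP, hne, Complex.I_ne_zero]

/-- The difference `℘(z) - ℘(w)` as a quotient of theta functions. -/
lemma exists_thetaFun_div_eq_mul_wp_sub {τ : ℂ} (hτ : 0 < τ.im) {w : ℂ}
    (hw : w ∉ (periodPair τ hτ).lattice) :
    ∃ c : ℂ, c ≠ 0 ∧ ∀ z ∉ (periodPair τ hτ).lattice,
      thetaFun τ (z - w) * thetaFun τ (z + w) / thetaFun τ z ^ 2 = c * (wp τ z - wp τ w) := by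
  set L := periodPair τ hτ with hL
  set h : ℂ → ℂ := fun z => thetaFun τ (z - w) * thetaFun τ (z + w) / thetaFun τ z ^ 2 with hh
  have hθ := differentiable_thetaFun hτ
  have h1 : Function.Periodic h 1 := fun z => by
    simp only [hh]
    rw [add_right_comm, add_sub_right_comm, thetaFun_add_one, thetaFun_add_one, thetaFun_add_one]
  have h2 : Function.Periodic h τ := fun z => by
    simp only [hh]
    rw [add_right_comm, add_sub_right_comm, thetaFun_add_self hτ, thetaFun_add_self hτ,
      thetaFun_add_self hτ]
    have e : expTwoPiI (z - w) * expTwoPiI (z + w) = expTwoPiI z ^ 2 := by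
      rw [← expTwoPiI_add, sq, ← expTwoPiI_add]; congr 1; ring
    have e1 := expTwoPiI_ne_zero z
    calc _ = (expTwoPiI (z - w) * expTwoPiI (z + w))⁻¹ *
          (thetaFun τ (z - w) * thetaFun τ (z + w)) / ((expTwoPiI z)⁻¹ ^ 2 * thetaFun τ z ^ 2) := by
            rw [mul_inv]; ring
      _ = _ := by
        rw [e, inv_pow, mul_div_mul_left _ _ (by positivity)]
  have hper : ∀ z, ∀ l ∈ L.lattice, h (z + l) = h z := by
    intro z l hl
    obtain ⟨m, n, rfl⟩ := mem_periodPair_lattice.1 hl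
    rw [← add_assoc, h2.int_mul n, ← mul_one (m : ℂ), h1.int_mul m]
  have hd : DifferentiableOn ℂ h (L.lattice : Set ℂ)ᶜ := by
    intro z hz
    have := thetaFun_ne_zero hτ hz
    refine DifferentiableAt.differentiableWithinAt ?_
    simp only [hh]
    exact DifferentiableAt.div (by fun_prop) (by fun_prop) (by positivity)
  set Ψ : ℂ → ℂ := dslope (thetaFun τ) 0 with hΨ
  have hΨz : ∀ z, thetaFun τ z = z * Ψ z := fun z => by
    have := sub_smul_dslope (thetaFun τ) 0 z
    simpa [thetaFun_zero hτ] using this.symm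
  have hΨ0 : Ψ 0 ≠ 0 := by
    rw [hΨ, dslope_same]; exact deriv_thetaFun_zero_ne_zero hτ
  have hΨd : Differentiable ℂ Ψ := by
    rw [← differentiableOn_univ, hΨ, Complex.differentiableOn_dslope Filter.univ_mem]
    exact hθ.differentiableOn
  have hΨneg : ∀ z, Ψ (-z) = (expTwoPiI z)⁻¹ * Ψ z := fun z => by
    rcases eq_or_ne z 0 with rfl | hz
    · simp
    have := thetaFun_neg hτ z
    rw [hΨz, hΨz z] at this
    apply mul_left_cancel₀ hz
    linear_combination -this
  set k : ℂ → ℂ := fun z => thetaFun τ (z - w) * thetaFun τ (z + w) / Ψ z ^ 2 with hk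
  have hka : AnalyticAt ℂ k 0 := by
    have a1 : AnalyticAt ℂ (fun z => thetaFun τ (z - w) * thetaFun τ (z + w)) 0 :=
      Differentiable.analyticAt (by fun_prop) 0
    have a2 : AnalyticAt ℂ (fun z => Ψ z ^ 2) 0 := Differentiable.analyticAt (by fun_prop) 0
    exact a1.div a2 (by positivity)
  have hkneg : ∀ z, k (-z) = k z := fun z => by
    simp only [hk]
    rw [show -z - w = -(z + w) by ring, show -z + w = -(z - w) by ring, thetaFun_neg hτ,
      thetaFun_neg hτ, hΨneg]
    have e : expTwoPiI (z - w) * expTwoPiI (z + w) = expTwoPiI z ^ 2 := by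
      rw [← expTwoPiI_add, sq, ← expTwoPiI_add]; congr 1; ring
    have e1 := expTwoPiI_ne_zero z
    calc _ = (expTwoPiI (z - w) * expTwoPiI (z + w))⁻¹ *
          (thetaFun τ (z - w) * thetaFun τ (z + w)) / ((expTwoPiI z)⁻¹ ^ 2 * Ψ z ^ 2) := by
            rw [mul_inv]; ring
      _ = _ := by
        rw [e, inv_pow, mul_div_mul_left _ _ (by positivity)]
  have hk' : deriv k 0 = 0 := by
    have e := deriv_comp_neg k 0
    simp only [hkneg, neg_zero] at e
    exact CharZero.eq_neg_self_iff.1 e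
  obtain ⟨H, hH, hHk⟩ : ∃ H, AnalyticAt ℂ H 0 ∧ ∀ᶠ z in nhds 0, k z - k 0 = (z - 0) ^ 2 • H z := by
    refine (natCast_le_analyticOrderAt (f := fun z => k z - k 0) (by fun_prop)).1 ?_
    rw [natCast_le_analyticOrderAt_iff_iteratedDeriv_eq_zero (by fun_prop)]
    intro i hi
    interval_cases i
    · simp
    · simp [iteratedDeriv_one, hk']
  obtain ⟨K, hK⟩ := L.exists_eq_mul_weierstrassP_add (c := k 0) hd hper hH (by
    rw [eventually_nhdsWithin_iff]
    filter_upwards [hHk] with z hz hz0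
    have hz0 : z ≠ 0 := hz0
    have : h z = k z / z ^ 2 := by
      simp only [hh, hk, hΨz z]
      rw [mul_pow, div_div, mul_comm (z ^ 2)]
    rw [this, eq_add_of_sub_eq hz]
    simp only [sub_zero, smul_eq_mul]
    field_simp
    ring)
  refine ⟨k 0, ?_, fun z hz => ?_⟩
  · have : -w ∉ L.lattice := fun h => hw (by simpa using L.lattice.neg_mem h)
    simp only [hk, zero_sub, zero_add]
    exact div_ne_zero (mul_ne_zero (thetaFun_ne_zero hτ this) (thetaFun_ne_zero hτ hw))
      (pow_ne_zero _ hΨ0)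
  · have e := hK w hw
    have e2 : h w = 0 := by simp [hh, thetaFun_zero hτ]
    rw [wp_eq_weierstrassP hτ, wp_eq_weierstrassP hτ]
    change h z = _
    rw [hK z hz]
    linear_combination e2 - e

/-- Quotients of differences of `℘`-values as theta quotients. -/
lemma wp_sub_div_wp_sub {τ : ℂ} (hτ : 0 < τ.im) {z₁ z₂ z₃ : ℂ}
    (h₁ : z₁ ∉ (periodPair τ hτ).lattice) (h₂ : z₂ ∉ (periodPair τ hτ).lattice)
    (h₃ : z₃ ∉ (periodPair τ hτ).lattice) :
    (wp τ z₁ - wp τ z₃) / (wp τ z₂ - wp τ z₃) =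
      (thetaFun τ (z₁ - z₃) * thetaFun τ (z₁ + z₃) / thetaFun τ z₁ ^ 2) /
      (thetaFun τ (z₂ - z₃) * thetaFun τ (z₂ + z₃) / thetaFun τ z₂ ^ 2) := by
  obtain ⟨c, hc, h⟩ := exists_thetaFun_div_eq_mul_wp_sub hτ h₃
  rw [h _ h₁, h _ h₂, mul_div_mul_left _ _ hc]

lemma moebius_denom_ne_zero {A : Matrix (Fin 2) (Fin 2) ℤ}
    (hA : A 0 0 * A 1 1 - A 0 1 * A 1 0 = 1) {τ : ℂ} (hτ : 0 < τ.im) :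
    (A 1 0 : ℂ) * τ + A 1 1 ≠ 0 := by
  intro h
  have h1 := congrArg Complex.im h
  have h2 := congrArg Complex.re h
  simp [hτ.ne'] at h1
  simp [h1] at h2
  simp [h1, h2] at hA

lemma moebius_im_pos {A : Matrix (Fin 2) (Fin 2) ℤ} (hA : A 0 0 * A 1 1 - A 0 1 * A 1 0 = 1)
    {τ : ℂ} (hτ : 0 < τ.im) : 0 < (moebius A τ).im := by
  have hJ := Complex.normSq_pos.2 (moebius_denom_ne_zero hA hτ)
  rw [moebius, Complex.div_im, ← sub_div]
  refine div_pos ?_ hJ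
  have hAR : (A 0 0 * A 1 1 - A 0 1 * A 1 0 : ℝ) = 1 := mod_cast hA
  simp
  linear_combination hτ - τ.im * hAR

/-- Homogeneity of `℘` under a change of basis of the lattice by an integral matrix of
determinant one. -/
lemma wp_moebius {A : Matrix (Fin 2) (Fin 2) ℤ} (hA : A 0 0 * A 1 1 - A 0 1 * A 1 0 = 1)
    {τ : ℂ} (hτ : 0 < τ.im) (z : ℂ) :
    wp (moebius A τ) z = (A 1 0 * τ + A 1 1) ^ 2 * wp τ (z * (A 1 0 * τ + A 1 1)) := by
  have hJ := moebius_denom_ne_zero hA hτ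
  let e : ℤ × ℤ ≃ ℤ × ℤ :=
    { toFun := fun p => (p.1 * A 1 1 + p.2 * A 0 1, p.1 * A 1 0 + p.2 * A 0 0)
      invFun := fun p => (p.1 * A 0 0 - p.2 * A 0 1, p.2 * A 1 1 - p.1 * A 1 0)
      left_inv := fun p => by
        ext
        · linear_combination p.1 * hA
        · linear_combination p.2 * hA
      right_inv := fun p => by
        ext
        · linear_combination p.1 * hA
        · linear_combination p.2 * hA }
  rw [wp_eq_tsum (moebius_im_pos hA hτ), wp_eq_tsum hτ,
    ← e.tsum_eq (fun p : ℤ × ℤ => 1 / (z * (A 1 0 * τ + A 1 1) - ((p.1 : ℂ) + p.2 * τ)) ^ 2 -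
      1 / ((p.1 : ℂ) + p.2 * τ) ^ 2), ← tsum_mul_left]
  refine tsum_congr fun p => ?_
  set J : ℂ := A 1 0 * τ + A 1 1 with hJd
  have key : (((e p).1 : ℤ) : ℂ) + ((e p).2 : ℤ) * τ =
      ((p.1 : ℂ) + (p.2 : ℂ) * moebius A τ) * J := by
    have : moebius A τ * J = A 0 0 * τ + A 0 1 := div_mul_cancel₀ _ hJ
    rw [add_mul, mul_assoc, this, hJd]
    simp only [e, Equiv.coe_fn_mk]
    push_cast
    ring
  rw [key, ← sub_mul, mul_pow, mul_pow, mul_sub]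
  have hJ2 : J ^ 2 ≠ 0 := pow_ne_zero _ hJ
  congr 1 <;> rw [one_div, one_div, mul_inv, mul_left_comm, mul_inv_cancel₀ hJ2, mul_one]

section TaylorCoefficients

variable {E : Type*} [NormedCommRing E] [NormedAlgebra ℂ E]

lemma DifferentiableOn.analyticAt_zero [CompleteSpace E] {F : ℂ → E}
    (hF : DifferentiableOn ℂ F (Metric.ball 0 1)) : AnalyticAt ℂ F 0 :=
  hF.analyticAt (Metric.ball_mem_nhds 0 one_pos)

lemma iteratedDeriv_pow_smul_eq_zero [CompleteSpace E] {H : ℂ → E} (hH : AnalyticAt ℂ H 0)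
    {k e : ℕ} (hk : k < e) :
    iteratedDeriv k (fun q => q ^ e • H q) 0 = 0 := by
  have ha : AnalyticAt ℂ (fun q => q ^ e • H q) 0 := by fun_prop
  exact (natCast_le_analyticOrderAt_iff_iteratedDeriv_eq_zero ha).1
    ((natCast_le_analyticOrderAt ha).2 ⟨H, hH, .of_forall fun z => by simp⟩) k hk

lemma TendstoLocallyUniformlyOn.iteratedDeriv [CompleteSpace E] {U : Set ℂ} (hU : IsOpen U)
    {F : ℕ → ℂ → E} {f : ℂ → E} (h : TendstoLocallyUniformlyOn F f Filter.atTop U)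
    (hF : ∀ n, DifferentiableOn ℂ (F n) U) (k : ℕ) :
    TendstoLocallyUniformlyOn (fun n => iteratedDeriv k (F n)) (iteratedDeriv k f)
      Filter.atTop U ∧ ∀ n, DifferentiableOn ℂ (iteratedDeriv k (F n)) U := by
  induction k with
  | zero => simpa using ⟨h, hF⟩
  | succ k ih =>
    simp only [iteratedDeriv_succ]
    exact ⟨ih.1.deriv (.of_forall ih.2) hU, fun n => (ih.2 n).deriv hU⟩

variable [Algebra ℚ E] {S : Subalgebra ℚ E} {F G : ℂ → E}

/-- `F` is holomorphic on the unit disc with all derivatives at the origin in `S`. -/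
def HasDerivsIn (S : Subalgebra ℚ E) (F : ℂ → E) : Prop :=
  DifferentiableOn ℂ F (Metric.ball 0 1) ∧ ∀ n, iteratedDeriv n F 0 ∈ S

namespace HasDerivsIn

lemma const {c : E} (hc : c ∈ S) : HasDerivsIn S fun _ => c := by
  refine ⟨by fun_prop, fun n => ?_⟩
  rw [iteratedDeriv_const]
  split_ifs
  exacts [hc, S.zero_mem]

lemma pow_smul (e : ℕ) {c : E} (hc : c ∈ S) : HasDerivsIn S fun q => q ^ e • c := by
  refine ⟨by fun_prop, fun n => ?_⟩
  rw [iteratedDeriv_smul_const (by fun_prop), iteratedDeriv_fun_pow_zero, Nat.cast_smul_eq_nsmul]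
  exact S.nsmul_mem hc _

variable [CompleteSpace E]

lemma contDiffAt (hF : HasDerivsIn S F) (n : ℕ) : ContDiffAt ℂ n F 0 :=
  hF.1.analyticAt_zero.contDiffAt

lemma sub (hF : HasDerivsIn S F) (hG : HasDerivsIn S G) :
    HasDerivsIn S fun q => F q - G q := by
  refine ⟨hF.1.sub hG.1, fun n => ?_⟩
  rw [iteratedDeriv_fun_sub (hF.contDiffAt n) (hG.contDiffAt n)]
  exact S.sub_mem (hF.2 n) (hG.2 n)

lemma mul (hF : HasDerivsIn S F) (hG : HasDerivsIn S G) :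
    HasDerivsIn S fun q => F q * G q := by
  refine ⟨hF.1.mul hG.1, fun n => ?_⟩
  rw [iteratedDeriv_fun_mul (hF.contDiffAt n) (hG.contDiffAt n)]
  exact S.sum_mem fun i _ => S.mul_mem (S.mul_mem (natCast_mem S _) (hF.2 _)) (hG.2 _)

lemma finsetProd {F : ℕ → ℂ → E} (hF : ∀ i, HasDerivsIn S (F i)) (s : Finset ℕ) :
    HasDerivsIn S fun q => ∏ i ∈ s, F i q := by
  induction s using Finset.induction_on with
  | empty => simpa using const S.one_mem
  | insert i s hi ih =>
    simp only [Finset.prod_insert hi]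
    exact (hF i).mul ih

lemma ringInverse (hS : ∀ x ∈ S, IsUnit x → Ring.inverse x ∈ S) (hF : HasDerivsIn S F)
    (hu : ∀ q ∈ Metric.ball (0 : ℂ) 1, IsUnit (F q)) :
    HasDerivsIn S fun q => Ring.inverse (F q) := by
  have h0 : (0 : ℂ) ∈ Metric.ball (0 : ℂ) 1 := Metric.mem_ball_self one_pos
  have hd : DifferentiableOn ℂ (fun q => Ring.inverse (F q)) (Metric.ball 0 1) := fun q hq =>
    (differentiableAt_inverse (hu q hq)).comp_differentiableWithinAt q (hF.1 q hq)
  refine ⟨hd, fun n => ?_⟩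
  induction n using Nat.strong_induction_on with
  | _ n ih =>
    have hinv := hS _ (by simpa using hF.2 0) (hu 0 h0)
    rcases Nat.eq_zero_or_pos n with rfl | hn
    · simpa using hinv
    have h1 : iteratedDeriv n (fun q => F q * Ring.inverse (F q)) 0 = 0 := by
      have e : (fun q => F q * Ring.inverse (F q)) =ᶠ[nhds 0] fun _ => 1 := by
        filter_upwards [Metric.ball_mem_nhds (0 : ℂ) one_pos] with q hq
        exact Ring.mul_inverse_cancel _ (hu q hq)
      rw [e.iteratedDeriv_eq, iteratedDeriv_const, if_neg hn.ne']
    rw [iteratedDeriv_fun_mul (hF.contDiffAt n) hd.analyticAt_zero.contDiffAt,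
      Finset.sum_range_succ'] at h1
    simp only [Nat.choose_zero_right, Nat.cast_one, one_mul, iteratedDeriv_zero,
      Nat.sub_zero] at h1
    have h2 : iteratedDeriv n (fun q => Ring.inverse (F q)) 0 = -(Ring.inverse (F 0) *
        ∑ i ∈ Finset.range n, ↑(n.choose (i + 1)) * iteratedDeriv (i + 1) F 0 *
          iteratedDeriv (n - (i + 1)) (fun q => Ring.inverse (F q)) 0) := by
      rw [eq_neg_of_add_eq_zero_left h1, mul_neg, neg_neg, ← mul_assoc,
        Ring.inverse_mul_cancel _ (hu 0 h0), one_mul]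
    rw [h2]
    refine S.neg_mem (S.mul_mem hinv (S.sum_mem fun i hi => ?_))
    exact S.mul_mem (S.mul_mem (natCast_mem S _) (hF.2 _)) (ih _ (by omega))

end HasDerivsIn

variable [CompleteSpace E] [NormOneClass E]

lemma HasDerivsIn.tprod {N : ℕ} (hN : 0 < N) (e : ℕ) {c : E} (hc : c ∈ S) :
    HasDerivsIn S fun q => ∏' n : ℕ, (1 + -(q ^ (N * n + e) • c)) := by
  have hU : IsOpen (Metric.ball (0 : ℂ) 1) := Metric.isOpen_ball
  have hfac : ∀ n, HasDerivsIn S fun q => 1 + -(q ^ (N * n + e) • c) := fun n => by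
    simpa [sub_eq_add_neg] using (const S.one_mem).sub (pow_smul (N * n + e) hc)
  have hpart := fun m => finsetProd hfac (Finset.range m)
  have hlim := (hasProdLocallyUniformlyOn_one_add_of_forall_compact hU
    (f := fun n q => -(q ^ (N * n + e) • c)) (fun n => by fun_prop) (fun K hK hKc => by
      obtain ⟨r, hr0, hr1, hr⟩ : ∃ r : ℝ, 0 ≤ r ∧ r < 1 ∧ ∀ x ∈ K, ‖x‖ ≤ r := by
        rcases K.eq_empty_or_nonempty with rfl | hne
        · exact ⟨0, le_rfl, one_pos, by simp⟩
        obtain ⟨y, hy, hmax⟩ := hKc.exists_isMaxOn hne continuous_norm.continuousOn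
        exact ⟨‖y‖, norm_nonneg _, by simpa using hK hy, fun x hx => hmax hx⟩
      refine ⟨fun n => r ^ n * ‖c‖, (summable_geometric_of_lt_one hr0 hr1).mul_right _,
        fun n x hx => ?_⟩
      rw [norm_neg, norm_smul, norm_pow]
      refine mul_le_mul_of_nonneg_right ?_ (norm_nonneg _)
      calc ‖x‖ ^ (N * n + e) ≤ r ^ (N * n + e) := by gcongr; exact hr x hx
        _ ≤ r ^ n := pow_le_pow_of_le_one hr0 hr1.le (by nlinarith))
    ).tendstoLocallyUniformlyOn_finsetRange
  refine ⟨hlim.differentiableOn (.of_forall fun m => (hpart m).1) hU, fun k => ?_⟩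
  have ht := (hlim.iteratedDeriv hU (fun m => (hpart m).1) k).1.tendsto_at
    (Metric.mem_ball_self one_pos)
  have hconst : ∀ m, k < m → iteratedDeriv k
      (fun q : ℂ => ∏ i ∈ Finset.range m, (1 + -(q ^ (N * i + e) • c))) 0 =
      iteratedDeriv k (fun q : ℂ => ∏ i ∈ Finset.range (k + 1), (1 + -(q ^ (N * i + e) • c))) 0 := by
    intro m hm
    induction m, hm using Nat.le_induction with
    | base => rfl
    | succ m hm ih =>
      rw [← ih, ← sub_eq_zero, ← iteratedDeriv_fun_sub ((hpart _).contDiffAt _)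
        ((hpart _).contDiffAt _)]
      have : (fun q : ℂ => ∏ i ∈ Finset.range (m + 1), (1 + -(q ^ (N * i + e) • c)) -
          ∏ i ∈ Finset.range m, (1 + -(q ^ (N * i + e) • c))) = fun q => q ^ (N * m + e) •
          (-(c * ∏ i ∈ Finset.range m, (1 + -(q ^ (N * i + e) • c)))) := by
        funext q
        rw [Finset.prod_range_succ, smul_neg, ← smul_mul_assoc]
        ring
      rw [this]
      have hm' := (hpart m).1.analyticAt_zero
      exact iteratedDeriv_pow_smul_eq_zero (by fun_prop) (by nlinarith)
  rw [tendsto_nhds_unique ht (tendsto_const_nhds.congr' (by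
    filter_upwards [Filter.eventually_gt_atTop k] with m hm using (hconst m hm).symm))]
  exact (hpart _).2 k

end TaylorCoefficients

section LaurentUnit

variable {E : Type*} [NormedCommRing E] [NormedAlgebra ℂ E] [Algebra ℚ E]
  {S : Subalgebra ℚ E} {f g : ℂ → E}

/-- On the punctured unit disc `f` is `q ^ s` times an invertible holomorphic function on the
unit disc whose derivatives at the origin lie in `S`. -/
def IsLaurentUnit (S : Subalgebra ℚ E) (f : ℂ → E) : Prop :=
  ∃ (s : ℤ) (F : ℂ → E), HasDerivsIn S F ∧ (∀ q ∈ Metric.ball (0 : ℂ) 1, IsUnit (F q)) ∧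
    ∀ q : ℂ, q ≠ 0 → ‖q‖ < 1 → f q = q ^ s • F q

namespace IsLaurentUnit

lemma congr (hf : IsLaurentUnit S f) (h : ∀ q : ℂ, q ≠ 0 → ‖q‖ < 1 → g q = f q) :
    IsLaurentUnit S g := by
  obtain ⟨s, F, hF, hu, hq⟩ := hf
  exact ⟨s, F, hF, hu, fun q h0 h1 => (h q h0 h1).trans (hq q h0 h1)⟩

lemma zpow_smul (s : ℤ) {c : E} (hc : c ∈ S) (hu : IsUnit c) :
    IsLaurentUnit S fun q => q ^ s • c :=
  ⟨s, fun _ => c, .const hc, fun _ _ => hu, fun _ _ _ => rfl⟩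

variable [CompleteSpace E]

lemma mul (hf : IsLaurentUnit S f) (hg : IsLaurentUnit S g) :
    IsLaurentUnit S fun q => f q * g q := by
  obtain ⟨s, F, hF, hFu, hf⟩ := hf
  obtain ⟨r, G, hG, hGu, hg⟩ := hg
  refine ⟨s + r, _, hF.mul hG, fun q hq => (hFu q hq).mul (hGu q hq), fun q h0 h1 => ?_⟩
  beta_reduce
  rw [hf q h0 h1, hg q h0 h1, smul_mul_smul_comm, zpow_add₀ h0]

end IsLaurentUnit

end LaurentUnit

lemma Prod.ringInverse_eq_inv {x : ℂ × ℂ} (hx : IsUnit x) : Ring.inverse x = x⁻¹ := by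
  have h := Ring.mul_inverse_cancel x hx
  ext
  · exact eq_inv_of_mul_eq_one_right (congrArg Prod.fst h)
  · exact eq_inv_of_mul_eq_one_right (congrArg Prod.snd h)

lemma IsLaurentUnit.div {S : Subalgebra ℚ (ℂ × ℂ)} {f g : ℂ → ℂ × ℂ}
    (hS : ∀ x ∈ S, IsUnit x → Ring.inverse x ∈ S) (hf : IsLaurentUnit S f)
    (hg : IsLaurentUnit S g) : IsLaurentUnit S fun q => f q / g q := by
  obtain ⟨s, G, hG, hGu, hg⟩ := hg
  have hinv : IsLaurentUnit S fun q => (g q)⁻¹ := by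
    refine ⟨-s, _, hG.ringInverse hS hGu, fun q hq => (hGu q hq).ringInverse,
      fun q h0 h1 => ?_⟩
    beta_reduce
    rw [hg q h0 h1, Prod.ringInverse_eq_inv (hGu q (by simpa using h1))]
    ext <;> simp [mul_comm]
  simpa only [div_eq_mul_inv] using hf.mul hinv

/-- The pairs `(P(x), P(y))` with `P` a rational polynomial. -/
noncomputable def conjSubalgebra (x y : ℂ) : Subalgebra ℚ (ℂ × ℂ) :=
  (Polynomial.aeval (R := ℚ) ((x, y) : ℂ × ℂ)).range

lemma mem_conjSubalgebra {x y : ℂ} {p : ℂ × ℂ} : p ∈ conjSubalgebra x y ↔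
    ∃ P : Polynomial ℚ, Polynomial.aeval x P = p.1 ∧ Polynomial.aeval y P = p.2 := by
  simp [conjSubalgebra, Polynomial.aeval_prod_apply, Prod.ext_iff]

section Conj

variable {N : ℕ} {x y : ℂ}

lemma ringInverse_mem_conjSubalgebra (hN : 0 < N) (hx : IsPrimitiveRoot x N)
    (hy : IsPrimitiveRoot y N) : ∀ p ∈ conjSubalgebra x y, IsUnit p →
      Ring.inverse p ∈ conjSubalgebra x y := by
  intro p hp hu
  obtain ⟨P, hP1, hP2⟩ := mem_conjSubalgebra.1 hp
  have hcx : Polynomial.aeval x (Polynomial.cyclotomic N ℚ) = 0 := by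
    rw [Polynomial.cyclotomic_eq_minpoly_rat hx hN, minpoly.aeval]
  have hcy : Polynomial.aeval y (Polynomial.cyclotomic N ℚ) = 0 := by
    rw [Polynomial.cyclotomic_eq_minpoly_rat hy hN, minpoly.aeval]
  obtain ⟨a, b, hab⟩ : IsCoprime (Polynomial.cyclotomic N ℚ) P := by
    rw [(Polynomial.cyclotomic.irreducible_rat hN).coprime_iff_not_dvd]
    rintro ⟨R, rfl⟩
    rw [map_mul, hcx, zero_mul] at hP1
    exact (Prod.isUnit_iff.1 hu).1.ne_zero hP1.symm
  have h1 := congrArg (Polynomial.aeval x) hab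
  have h2 := congrArg (Polynomial.aeval y) hab
  simp only [map_add, map_mul, hcx, hcy, mul_zero, zero_add, map_one, hP1, hP2] at h1 h2
  refine mem_conjSubalgebra.2 ⟨b, ?_, ?_⟩ <;> rw [Prod.ringInverse_eq_inv hu]
  · exact eq_inv_of_mul_eq_one_left h1
  · exact eq_inv_of_mul_eq_one_left h2

lemma zpow_mem_conjSubalgebra (hN : 0 < N) (hx : IsPrimitiveRoot x N)
    (hy : IsPrimitiveRoot y N) (c : ℤ) : (x ^ c, y ^ c) ∈ conjSubalgebra x y := by
  have key : ∀ {z : ℂ}, IsPrimitiveRoot z N → z ^ c = z ^ (c % N).toNat := fun {z} hz => by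
    rw [← zpow_natCast, Int.toNat_of_nonneg (Int.emod_nonneg _ (by omega))]
    conv_lhs => rw [← Int.emod_add_mul_ediv c N]
    rw [zpow_add₀ (hz.ne_zero hN.ne'), zpow_mul, zpow_natCast, hz.pow_eq_one, one_zpow, mul_one]
  exact mem_conjSubalgebra.2 ⟨Polynomial.X ^ (c % N).toNat, by simp [key hx], by simp [key hy]⟩

lemma tprod_one_add_neg_pow_smul (hN : 0 < N) {q : ℂ} (hq : ‖q‖ < 1) (e : ℕ) (x y : ℂ) :
    ∏' n : ℕ, (1 + -(q ^ (N * n + e) • ((x, y) : ℂ × ℂ))) =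
      (qPoch (q ^ N) (q ^ e * x), qPoch (q ^ N) (q ^ e * y)) := by
  have hs : Summable fun n : ℕ => ‖-(q ^ (N * n + e) • ((x, y) : ℂ × ℂ))‖ := by
    have hqN : ‖q‖ ^ N < 1 := pow_lt_one₀ (norm_nonneg _) hq hN.ne'
    refine ((summable_geometric_of_lt_one (by positivity) hqN).mul_right
      (‖q‖ ^ e * ‖((x, y) : ℂ × ℂ)‖)).congr fun n => ?_
    rw [norm_neg, norm_smul, norm_pow, pow_add, pow_mul, mul_assoc]
  have hm := multipliable_one_add_of_summable hs
  ext
  · refine (hm.map_tprod (RingHom.fst ℂ ℂ) continuous_fst).trans (tprod_congr fun n => ?_)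
    simp [pow_add, pow_mul, mul_assoc]
  · refine (hm.map_tprod (RingHom.snd ℂ ℂ) continuous_snd).trans (tprod_congr fun n => ?_)
    simp [pow_add, pow_mul, mul_assoc]

lemma qPoch_pow_ne_zero (hN : 0 < N) (hx : IsPrimitiveRoot x N) {q : ℂ} (hq : ‖q‖ < 1) {e : ℕ}
    {c : ℤ} (hec : e = 0 → ¬ (N : ℤ) ∣ c) : qPoch (q ^ N) (q ^ e * x ^ c) ≠ 0 := by
  have hqN : ‖q ^ N‖ < 1 := by
    rw [norm_pow]; exact pow_lt_one₀ (norm_nonneg _) hq hN.ne'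
  refine qPoch_ne_zero hqN fun n h => ?_
  rw [← mul_assoc, ← pow_mul, ← pow_add] at h
  rcases eq_or_ne (N * n + e) 0 with h0 | h0
  · rw [h0, pow_zero, one_mul, hx.zpow_eq_one_iff_dvd] at h
    exact hec (by omega) h
  · have h1 := congrArg norm h
    rw [norm_mul, norm_zpow, hx.norm'_eq_one hN.ne', one_zpow, mul_one, norm_one, norm_pow] at h1
    exact (pow_lt_one₀ (norm_nonneg _) hq h0).ne h1

lemma isLaurentUnit_thetaProd_of_lt (hN : 0 < N) (hx : IsPrimitiveRoot x N)
    (hy : IsPrimitiveRoot y N) {b : ℕ} (hb : b < N) {c : ℤ} (hbc : b = 0 → ¬ (N : ℤ) ∣ c) :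
    IsLaurentUnit (conjSubalgebra x y) fun q =>
      (thetaProd (q ^ N) (q ^ (b : ℤ) * x ^ c), thetaProd (q ^ N) (q ^ (b : ℤ) * y ^ c)) := by
  have h1 := HasDerivsIn.tprod hN b (zpow_mem_conjSubalgebra hN hx hy c)
  have h2 := HasDerivsIn.tprod hN (N - b) (zpow_mem_conjSubalgebra hN hx hy (-c))
  refine ⟨0, _, h1.mul h2, fun q hq => ?_, fun q h0 hq => ?_⟩
  · have hq : ‖q‖ < 1 := by simpa using hq
    rw [tprod_one_add_neg_pow_smul hN hq, tprod_one_add_neg_pow_smul hN hq]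
    refine IsUnit.mul (Prod.isUnit_iff.2 ?_) (Prod.isUnit_iff.2 ?_)
    · exact ⟨(qPoch_pow_ne_zero hN hx hq hbc).isUnit, (qPoch_pow_ne_zero hN hy hq hbc).isUnit⟩
    · exact ⟨(qPoch_pow_ne_zero hN hx hq (by omega)).isUnit,
        (qPoch_pow_ne_zero hN hy hq (by omega)).isUnit⟩
  · rw [tprod_one_add_neg_pow_smul hN hq, tprod_one_add_neg_pow_smul hN hq, zpow_zero, one_smul,
      Prod.mk_mul_mk]
    have key : ∀ z : ℂ, q ^ N * (q ^ (b : ℤ) * z ^ c)⁻¹ = q ^ (N - b) * z ^ (-c) := fun z => by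
      rw [mul_inv, ← mul_assoc, zpow_neg, zpow_natCast, pow_sub₀ q h0 hb.le]
    simp only [thetaProd, key]
    simp only [zpow_natCast]

lemma isLaurentUnit_thetaProd_add_iff (hN : 0 < N) (hx : IsPrimitiveRoot x N)
    (hy : IsPrimitiveRoot y N) (b c : ℤ) :
    IsLaurentUnit (conjSubalgebra x y) (fun q =>
      (thetaProd (q ^ N) (q ^ (b + N) * x ^ c), thetaProd (q ^ N) (q ^ (b + N) * y ^ c))) ↔
    IsLaurentUnit (conjSubalgebra x y) (fun q =>
      (thetaProd (q ^ N) (q ^ b * x ^ c), thetaProd (q ^ N) (q ^ b * y ^ c))) := by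
  have hx0 := hx.ne_zero hN.ne'
  have hy0 := hy.ne_zero hN.ne'
  have hmon : ∀ s d : ℤ, IsLaurentUnit (conjSubalgebra x y)
      fun q => q ^ s • (-(x ^ d, y ^ d) : ℂ × ℂ) := fun s d =>
    .zpow_smul s ((conjSubalgebra x y).neg_mem (zpow_mem_conjSubalgebra hN hx hy d))
      (Prod.isUnit_iff.2 ⟨(zpow_ne_zero d hx0).isUnit, (zpow_ne_zero d hy0).isUnit⟩).neg
  have key : ∀ {z q : ℂ}, z ≠ 0 → q ≠ 0 → ‖q‖ < 1 → thetaProd (q ^ N) (q ^ (b + N) * z ^ c) =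
      q ^ (-b) * (-(z ^ (-c))) * thetaProd (q ^ N) (q ^ b * z ^ c) := fun {z q} hz h0 hq => by
    rw [zpow_add₀ h0, zpow_natCast, mul_comm (q ^ b), mul_assoc, thetaProd_mul
      (by rw [norm_pow]; exact pow_lt_one₀ (norm_nonneg _) hq hN.ne') (pow_ne_zero _ h0)
      (mul_ne_zero (zpow_ne_zero _ h0) (zpow_ne_zero _ hz)), mul_inv, zpow_neg, zpow_neg]
    ring
  refine ⟨fun h => ((hmon b c).mul h).congr fun q h0 hq => ?_,
    fun h => ((hmon (-b) (-c)).mul h).congr fun q h0 hq => ?_⟩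
  · rw [key hx0 h0 hq, key hy0 h0 hq]
    have h0' := zpow_ne_zero b h0
    have hx' := zpow_ne_zero c hx0
    have hy' := zpow_ne_zero c hy0
    ext
    · simp only [zpow_neg, Prod.fst_mul, Prod.smul_fst, Prod.fst_neg, smul_eq_mul]
      field_simp
    · simp only [zpow_neg, Prod.snd_mul, Prod.smul_snd, Prod.snd_neg, smul_eq_mul]
      field_simp
  · rw [key hx0 h0 hq, key hy0 h0 hq]
    rfl

lemma isLaurentUnit_thetaProd (hN : 0 < N) (hx : IsPrimitiveRoot x N)
    (hy : IsPrimitiveRoot y N) {b c : ℤ} (hbc : (N : ℤ) ∣ b → ¬ (N : ℤ) ∣ c) :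
    IsLaurentUnit (conjSubalgebra x y) fun q =>
      (thetaProd (q ^ N) (q ^ b * x ^ c), thetaProd (q ^ N) (q ^ b * y ^ c)) := by
  obtain ⟨r, hr⟩ := Int.eq_ofNat_of_zero_le (Int.emod_nonneg b (by omega : (N : ℤ) ≠ 0))
  have hrN := Int.emod_lt_of_pos b (by omega : (0 : ℤ) < N)
  have hb := Int.emod_add_mul_ediv b N
  rw [hr] at hb hrN
  rw [← hb]
  generalize b / N = m
  induction m using Int.induction_on with
  | zero =>
    rw [mul_zero, add_zero]
    refine isLaurentUnit_thetaProd_of_lt hN hx hy (by omega) fun h => hbc ?_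
    exact Int.dvd_of_emod_eq_zero (by omega)
  | succ m ih =>
    rw [mul_add, mul_one, ← add_assoc]
    exact (isLaurentUnit_thetaProd_add_iff hN hx hy _ c).2 ih
  | pred m ih =>
    rw [← isLaurentUnit_thetaProd_add_iff hN hx hy]
    rwa [mul_sub, mul_one, add_assoc, sub_add_cancel]

/-- The two components of a Laurent unit over `conjSubalgebra x y` have Laurent expansions with
coefficients `P n` evaluated at `x` and at `y`. -/
lemma IsLaurentUnit.exists_hasSum {f : ℂ → ℂ × ℂ} (hf : IsLaurentUnit (conjSubalgebra x y) f) :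
    ∃ (n₀ : ℤ) (P : ℤ → Polynomial ℚ), (∀ n < n₀, P n = 0) ∧ ∀ q : ℂ, q ≠ 0 → ‖q‖ < 1 →
      HasSum (fun n : ℤ => Polynomial.aeval x (P n) * q ^ n) (f q).1 ∧
      HasSum (fun n : ℤ => Polynomial.aeval y (P n) * q ^ n) (f q).2 := by
  obtain ⟨s, F, hF, -, hf⟩ := hf
  choose p hpx hpy using fun n => mem_conjSubalgebra.1 (hF.2 n)
  refine ⟨s, fun n => if n < s then 0 else
    Polynomial.C (((n - s).toNat.factorial : ℚ)⁻¹) * p (n - s).toNat,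
    fun n hn => if_pos hn, fun q h0 hq => ?_⟩
  have h := (Complex.hasSum_taylorSeries_on_ball hF.1 (z := q) (by simpa using hq)).const_smul
    (q ^ s)
  rw [← hf q h0 hq] at h
  have hinj : Function.Injective fun n : ℕ => (n : ℤ) + s := fun m n h => by simpa using h
  have hrange : ∀ n ∉ Set.range fun n : ℕ => (n : ℤ) + s, n < s := fun n hn => by
    by_contra! h
    exact hn ⟨(n - s).toNat, by simp [h]⟩
  constructor
  · rw [← hinj.hasSum_iff fun n hn => by simp [hrange n hn]]
    convert h.map (ContinuousLinearMap.fst ℂ ℂ ℂ) (by fun_prop) using 1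
    · funext n
      have hn : ¬ (n : ℤ) < 0 := by omega
      simp [zpow_add₀ h0, ← hpx, hn]
      ring
    · rfl
  · rw [← hinj.hasSum_iff fun n hn => by simp [hrange n hn]]
    convert h.map (ContinuousLinearMap.snd ℂ ℂ ℂ) (by fun_prop) using 1
    · funext n
      have hn : ¬ (n : ℤ) < 0 := by omega
      simp [zpow_add₀ h0, ← hpy, hn]
      ring
    · rfl

end Conj

lemma wp_add_of_mem {τ : ℂ} (hτ : 0 < τ.im) {z w : ℂ} (hw : w ∈ (periodPair τ hτ).lattice) :
    wp τ (z + w) = wp τ z := by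
  rw [wp_eq_weierstrassP hτ, wp_eq_weierstrassP hτ]
  exact (periodPair τ hτ).weierstrassP_add_coe z ⟨w, hw⟩

lemma wp_neg {τ : ℂ} (hτ : 0 < τ.im) (z : ℂ) : wp τ (-z) = wp τ z := by
  rw [wp_eq_weierstrassP hτ, wp_eq_weierstrassP hτ]
  exact (periodPair τ hτ).weierstrassP_neg z

lemma wp_add_int {τ : ℂ} (hτ : 0 < τ.im) (z : ℂ) (m : ℤ) : wp τ (z + m) = wp τ z :=
  wp_add_of_mem hτ (mem_periodPair_lattice.2 ⟨m, 0, by simp⟩)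

lemma wp_red_div {N : ℕ} (hN : 0 < N) {τ : ℂ} (hτ : 0 < τ.im) (a : ℤ) :
    wp τ ((red N a : ℂ) / N) = wp τ ((a : ℂ) / N) := by
  have hN0 : (N : ℂ) ≠ 0 := by exact_mod_cast hN.ne'
  have hmod : ((a % N : ℤ) : ℂ) = a - N * (a / N : ℤ) := by
    have := Int.emod_add_mul_ediv a N
    rw [eq_sub_iff_add_eq]
    exact_mod_cast this
  rw [red]
  split_ifs
  · rw [← wp_add_int hτ _ (a / N)]
    congr 1
    rw [hmod]
    field_simp
    ring
  · rw [← wp_neg hτ, ← wp_add_int hτ _ (1 + a / N)]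
    congr 1
    push_cast [hmod]
    field_simp
    ring

lemma Wfun_moebius {A : Matrix (Fin 2) (Fin 2) ℤ} (hA : A 0 0 * A 1 1 - A 0 1 * A 1 0 = 1)
    {τ : ℂ} (hτ : 0 < τ.im) (N : ℕ) (a b c : ℤ) :
    Wfun N a b c (moebius A τ) =
      (wp τ (a * (A 1 0 * τ + A 1 1) / N) - wp τ (c * (A 1 0 * τ + A 1 1) / N)) /
        (wp τ (b * (A 1 0 * τ + A 1 1) / N) - wp τ (c * (A 1 0 * τ + A 1 1) / N)) := by
  simp only [Wfun, wp_moebius hA hτ, ← mul_sub, div_mul_eq_mul_div]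
  exact mul_div_mul_left _ _ (pow_ne_zero 2 (moebius_denom_ne_zero hA hτ))

lemma Bmat_det {t : ℕ} {u v : ℤ} (k : ℤ) (huv : u * v ≡ 1 [ZMOD (t : ℤ)]) :
    Bmat t u v k 0 0 * Bmat t u v k 1 1 - Bmat t u v k 0 1 * Bmat t u v k 1 0 = 1 := by
  obtain ⟨m, hm⟩ := huv.symm.dvd
  rcases eq_or_ne (t : ℤ) 0 with h0 | h0
  · simp [Bmat, h0] at hm ⊢
    linarith
  · simp [Bmat, hm, Int.mul_ediv_cancel_left m h0]
    linear_combination hm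

section Ratio

variable {N : ℕ}

lemma qq_ne_zero (N : ℕ) (τ : ℂ) : qq N τ ≠ 0 := Complex.exp_ne_zero _

lemma norm_qq_lt_one (hN : 0 < N) {τ : ℂ} (hτ : 0 < τ.im) : ‖qq N τ‖ < 1 := by
  have h : 0 < (τ / N).im := by
    rw [Complex.div_natCast_im]
    positivity
  simpa [qq, expTwoPiI, mul_div_assoc] using norm_expTwoPiI_lt_one h

lemma thetaFun_div (hN : 0 < N) (τ : ℂ) (b c : ℤ) :
    thetaFun τ ((b * τ + c) / N) = thetaProd (qq N τ ^ N) (qq N τ ^ b * zetaN N ^ c) := by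
  have hN0 : (N : ℂ) ≠ 0 := by exact_mod_cast hN.ne'
  have hq : qq N τ = expTwoPiI (τ / N) := by rw [qq, expTwoPiI, mul_div_assoc]
  have hz : zetaN N = expTwoPiI (1 / N) := by rw [zetaN, expTwoPiI, mul_one_div]
  have hqN : expTwoPiI τ = qq N τ ^ N := by
    rw [hq, ← zpow_natCast, ← expTwoPiI_int_mul]
    congr 1
    push_cast
    field_simp
  rw [thetaFun, hqN, hq, hz, ← expTwoPiI_int_mul, ← expTwoPiI_int_mul, ← expTwoPiI_add]
  congr 2
  ring

/-- The combination of theta values expressing `W_𝔞`. -/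
noncomputable def thetaRatio {R : Type*} [Div R] [Mul R] (T : ℤ → R) (a : ℤ × ℤ × ℤ) : R :=
  (T (a.1 - a.2.2) * T (a.1 + a.2.2) / (T a.1 * T a.1)) /
    (T (a.2.1 - a.2.2) * T (a.2.1 + a.2.2) / (T a.2.1 * T a.2.1))

lemma memE.not_dvd {a : ℤ × ℤ × ℤ} (ha : memE N a) :
    ¬ (N : ℤ) ∣ a.1 ∧ ¬ (N : ℤ) ∣ a.2.1 ∧ ¬ (N : ℤ) ∣ a.2.2 ∧ ¬ (N : ℤ) ∣ a.1 - a.2.2 ∧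
      ¬ (N : ℤ) ∣ a.1 + a.2.2 ∧ ¬ (N : ℤ) ∣ a.2.1 - a.2.2 ∧ ¬ (N : ℤ) ∣ a.2.1 + a.2.2 := by
  obtain ⟨h1, h2, h3, h4, h5, h6, h7, h8, h9⟩ := ha
  have key : ∀ s : ℤ, s ≠ 0 → |s| < N → ¬ (N : ℤ) ∣ s := fun s h0 hs h =>
    h0 (Int.eq_zero_of_abs_lt_dvd h hs)
  refine ⟨key _ ?_ ?_, key _ ?_ ?_, key _ ?_ ?_, key _ ?_ ?_, key _ ?_ ?_, key _ ?_ ?_,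
    key _ ?_ ?_⟩
  all_goals first | omega | (rw [abs_lt]; constructor <;> omega)

lemma not_mem_lattice_of_not_dvd (hN : 0 < N) {τ : ℂ} (hτ : 0 < τ.im) {r d s : ℤ}
    (hrd : (N : ℤ) ∣ s * r → ¬ (N : ℤ) ∣ s * d) :
    (s : ℂ) * (r * τ + d) / N ∉ (periodPair τ hτ).lattice := by
  have hN0 : (N : ℂ) ≠ 0 := by exact_mod_cast hN.ne'
  rw [mem_periodPair_lattice]
  rintro ⟨m, n, h⟩
  rw [eq_div_iff hN0] at h
  have h1 := congrArg Complex.im h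
  simp at h1
  have h1' : (n * N : ℝ) = s * r := mul_right_cancel₀ hτ.ne' (by linear_combination h1)
  have h1'' : n * N = s * r := by exact_mod_cast h1'
  have h2 : (m * N : ℂ) = s * d := by
    have : (n * N : ℂ) = s * r := by exact_mod_cast h1''
    linear_combination h - τ * this
  exact hrd ⟨n, by linarith⟩ ⟨m, by rw [mul_comm _ m]; exact_mod_cast h2.symm⟩

lemma wp_ratio_eq_thetaRatio (hN : 0 < N) {τ : ℂ} (hτ : 0 < τ.im) {a : ℤ × ℤ × ℤ}
    (ha : memE N a) {r d : ℤ} (hrd : ∀ s : ℤ, (N : ℤ) ∣ s * r → (N : ℤ) ∣ s * d → (N : ℤ) ∣ s) :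
    (wp τ (a.1 * (r * τ + d) / N) - wp τ (a.2.2 * (r * τ + d) / N)) /
        (wp τ (a.2.1 * (r * τ + d) / N) - wp τ (a.2.2 * (r * τ + d) / N)) =
      thetaRatio (fun s => thetaProd (qq N τ ^ N) (qq N τ ^ (s * r) * zetaN N ^ (s * d))) a := by
  have hm : ∀ s : ℤ, ¬ (N : ℤ) ∣ s → (s : ℂ) * (r * τ + d) / N ∉ (periodPair τ hτ).lattice :=
    fun s hs => not_mem_lattice_of_not_dvd hN hτ fun h h' => hs (hrd s h h')
  obtain ⟨h1, h2, h3, -⟩ := ha.not_dvd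
  rw [wp_sub_div_wp_sub hτ (hm _ h1) (hm _ h2) (hm _ h3)]
  simp only [thetaRatio, ← thetaFun_div hN, sq]
  push_cast
  congr <;> ring

lemma exists_hasSum_wp_ratio (hN : 0 < N) {a : ℤ × ℤ × ℤ} (ha : memE N a) {l r d : ℤ}
    (hl : IsCoprime l (N : ℤ))
    (hrd : ∀ s : ℤ, (N : ℤ) ∣ s * r → (N : ℤ) ∣ s * d → (N : ℤ) ∣ s) :
    ∃ (n₀ : ℤ) (P : ℤ → Polynomial ℚ), (∀ n < n₀, P n = 0) ∧ ∀ τ : ℂ, 0 < τ.im →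
      HasSum (fun n : ℤ => Polynomial.aeval (zetaN N) (P n) * qq N τ ^ n)
        ((wp τ (a.1 * (r * τ + d) / N) - wp τ (a.2.2 * (r * τ + d) / N)) /
          (wp τ (a.2.1 * (r * τ + d) / N) - wp τ (a.2.2 * (r * τ + d) / N))) ∧
      HasSum (fun n : ℤ => Polynomial.aeval (zetaN N ^ l) (P n) * qq N τ ^ n)
        ((wp τ (a.1 * (r * τ + (l * d : ℤ)) / N) - wp τ (a.2.2 * (r * τ + (l * d : ℤ)) / N)) /
          (wp τ (a.2.1 * (r * τ + (l * d : ℤ)) / N) -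
            wp τ (a.2.2 * (r * τ + (l * d : ℤ)) / N))) := by
  have hx : IsPrimitiveRoot (zetaN N) N := Complex.isPrimitiveRoot_exp N hN.ne'
  have hy : IsPrimitiveRoot (zetaN N ^ l) N :=
    hx.zpow_of_gcd_eq_one l (Int.isCoprime_iff_gcd_eq_one.1 hl)
  have hinv := ringInverse_mem_conjSubalgebra hN hx hy
  have hT : ∀ s : ℤ, ¬ (N : ℤ) ∣ s → IsLaurentUnit (conjSubalgebra (zetaN N) (zetaN N ^ l)) fun q =>
      (thetaProd (q ^ N) (q ^ (s * r) * zetaN N ^ (s * d)),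
        thetaProd (q ^ N) (q ^ (s * r) * (zetaN N ^ l) ^ (s * d))) := fun s hs =>
    isLaurentUnit_thetaProd hN hx hy fun h h' => hs (hrd s h h')
  have hld : ∀ s : ℤ, (N : ℤ) ∣ s * r → (N : ℤ) ∣ s * (l * d) → (N : ℤ) ∣ s :=
    fun s h h' => hrd s h (hl.symm.dvd_of_dvd_mul_left (by rwa [mul_left_comm] at h'))
  obtain ⟨h1, h2, -, h4, h5, h6, h7⟩ := ha.not_dvd
  have hW : IsLaurentUnit (conjSubalgebra (zetaN N) (zetaN N ^ l)) fun q => thetaRatio (fun s : ℤ =>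
      ((thetaProd (q ^ N) (q ^ (s * r) * zetaN N ^ (s * d)),
        thetaProd (q ^ N) (q ^ (s * r) * (zetaN N ^ l) ^ (s * d))) : ℂ × ℂ)) a :=
    .div hinv (.div hinv ((hT _ h4).mul (hT _ h5)) ((hT _ h1).mul (hT _ h1)))
      (.div hinv ((hT _ h6).mul (hT _ h7)) ((hT _ h2).mul (hT _ h2)))
  obtain ⟨n₀, P, hP, hsum⟩ := hW.exists_hasSum
  refine ⟨n₀, P, hP, fun τ hτ => ?_⟩
  have h := hsum _ (qq_ne_zero N τ) (norm_qq_lt_one hN hτ)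
  rw [wp_ratio_eq_thetaRatio hN hτ ha hrd, wp_ratio_eq_thetaRatio hN hτ ha hld]
  simp only [mul_left_comm _ l d, zpow_mul _ l]
  exact h

end Ratio

/-- Proposition 3.3 (i) of the paper. `W_𝔞∘B(t,u,v,k)` (for `𝔞 ∈ 𝔈₁`) has a
`q`-expansion with coefficients `c_n = P_n(ζ) ∈ ℚ(ζ)`, vanishing below some bound, and applying
`σ_ℓ` to the coefficients yields the `q`-expansion of `W_{ℓ𝔞}∘B(t,u,v,k)` if `t = N`, and of
`W_𝔞∘B(t,ℓ*u,ℓv,ℓk)` if `t ≠ N`; here `ℓ𝔞 = [{ℓa₁},{ℓa₂},{ℓa₃}]`. -/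
theorem stmt11 (N : ℕ) (hN : 0 < N) (a : ℤ × ℤ × ℤ) (ha : memE1 N a)
    (t : ℕ) (ht : t ∣ N) (ht0 : 0 < t)
    (u v k : ℤ) (hu : IsCoprime u (t : ℤ)) (huv : u * v ≡ 1 [ZMOD (t : ℤ)])
    (l ls : ℤ) (hl : IsCoprime l (N : ℤ)) (hls : l * ls ≡ 1 [ZMOD (N : ℤ)]) :
    ∃ (n₀ : ℤ) (P : ℤ → Polynomial ℚ), (∀ n : ℤ, n < n₀ → P n = 0) ∧
      ∀ τ : ℂ, 0 < τ.im →
        (Summable (fun n : ℤ => Polynomial.aeval (zetaN N) (P n) * qq N τ ^ n) ∧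
          Wfun N a.1 a.2.1 a.2.2 (moebius (Bmat t u v k) τ) =
            ∑' n : ℤ, Polynomial.aeval (zetaN N) (P n) * qq N τ ^ n) ∧
        (Summable (fun n : ℤ => Polynomial.aeval (zetaN N ^ l) (P n) * qq N τ ^ n) ∧
          (t = N →
            Wfun N (red N (l * a.1)) (red N (l * a.2.1)) (red N (l * a.2.2))
                (moebius (Bmat t u v k) τ) =
              ∑' n : ℤ, Polynomial.aeval (zetaN N ^ l) (P n) * qq N τ ^ n) ∧
          (t ≠ N →
            Wfun N a.1 a.2.1 a.2.2 (moebius (Bmat t (ls * u) (l * v) (l * k)) τ) =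
              ∑' n : ℤ, Polynomial.aeval (zetaN N ^ l) (P n) * qq N τ ^ n)) := by
  have hNC : (N : ℂ) ≠ 0 := by exact_mod_cast hN.ne'
  have hdet := Bmat_det k huv
  have hls' : l * ls ≡ 1 [ZMOD (t : ℤ)] := hls.of_dvd (by exact_mod_cast ht)
  have huv' : ls * u * (l * v) ≡ 1 [ZMOD (t : ℤ)] := by
    have := hls'.mul huv
    rwa [mul_one, show l * ls * (u * v) = ls * u * (l * v) by ring] at this
  have hdet' := Bmat_det (l * k) huv'
  have hrow : ∀ u v k : ℤ, Bmat t u v k 1 0 = t ∧ Bmat t u v k 1 1 = v + t * k :=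
    fun _ _ _ => ⟨rfl, rfl⟩
  have hdvd : ∀ s : ℤ, (N : ℤ) ∣ s * t → (N : ℤ) ∣ s * (v + t * k) → (N : ℤ) ∣ s := by
    intro s h1 h2
    rw [(hrow u v k).1, (hrow u v k).2] at hdet
    have : s = s * (v + t * k) * Bmat t u v k 0 0 - s * t * Bmat t u v k 0 1 := by
      linear_combination -s * hdet
    rw [this]
    exact dvd_sub (h2.mul_right _) (h1.mul_right _)
  by_cases htN : t = N
  · subst htN
    obtain ⟨n₀, P, hP, h⟩ := exists_hasSum_wp_ratio hN ha.1 (r := 0) (d := v + t * k) hl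
      fun s _ h => hdvd s (dvd_mul_left _ _) h
    have hper : ∀ {τ : ℂ}, 0 < τ.im → ∀ b d : ℤ,
        wp τ (b * (t * τ + d) / t) = wp τ (b * ((0 : ℤ) * τ + d) / t) := fun {τ} hτ b d => by
      rw [← wp_add_of_mem hτ (z := b * ((0 : ℤ) * τ + d) / t)
        (mem_periodPair_lattice.2 ⟨0, b, rfl⟩)]
      congr 1
      push_cast
      field_simp
      ring
    refine ⟨n₀, P, hP, fun τ hτ => ?_⟩
    obtain ⟨h1, h2⟩ := h τ hτ
    refine ⟨⟨h1.summable, ?_⟩, h2.summable, fun _ => ?_, fun h => absurd rfl h⟩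
    · rw [h1.tsum_eq, Wfun_moebius hdet hτ, (hrow u v k).1, (hrow u v k).2]
      simp only [Int.cast_natCast, hper hτ]
    · have hred : ∀ b c d : ℤ, Wfun t (red t b) (red t c) (red t d) (moebius (Bmat t u v k) τ) =
          Wfun t b c d (moebius (Bmat t u v k) τ) := fun b c d => by
        simp only [Wfun, wp_red_div hN (moebius_im_pos hdet hτ)]
      rw [h2.tsum_eq, hred, Wfun_moebius hdet hτ, (hrow u v k).1, (hrow u v k).2]
      have hcomm : ∀ b : ℤ, (((l * b : ℤ) : ℂ) * ((0 : ℤ) * τ + (v + t * k : ℤ)) / t) =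
          b * ((0 : ℤ) * τ + (l * (v + t * k) : ℤ)) / t := fun b => by
        push_cast
        ring
      simp only [Int.cast_natCast, hper hτ, hcomm]
  · obtain ⟨n₀, P, hP, h⟩ := exists_hasSum_wp_ratio hN ha.1 (r := t) (d := v + t * k) hl hdvd
    refine ⟨n₀, P, hP, fun τ hτ => ?_⟩
    obtain ⟨h1, h2⟩ := h τ hτ
    refine ⟨⟨h1.summable, ?_⟩, h2.summable, fun h => absurd h htN, fun _ => ?_⟩
    · rw [h1.tsum_eq, Wfun_moebius hdet hτ, (hrow u v k).1, (hrow u v k).2]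
    · rw [h2.tsum_eq, Wfun_moebius hdet' hτ, (hrow _ _ _).1, (hrow _ _ _).2,
        show l * (v + t * k) = l * v + t * (l * k) by ring]
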